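/- Let G be the claw with center a and leaves b, c, d, with edge ideal I = (ab, ac, ad), and let t ≥ 2. Then the minimal generating set of I^t is exactly { m(i,j,k) := a^t b^i c^j d^k : i + j + k = t }, which has binom(t+2,2) elements. A two-element set {m(i,j,k), m(i',j',k')} of distinct minimal generators is a Scarf face of I^t if and only if one of the following holds: (k = k' = 0 and |i - i'| = 1), or (j = j' = 0 and |i - i'| = 1), or (i = i' = 0 and |j - j'| = 1); moreover no Scarf face of I^t has more than two elements. Thus Scarf(I^t) consists of a cycle of length 3t together with binom(t+2,2) − 3t isolated vertices. -/

import Mathlib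

/-- The monomial (exponent vector) of an edge: `1` on its endpoints, `0` elsewhere. -/
def edgeMon {V : Type*} [DecidableEq V] (e : Sym2 V) : V → ℕ :=
  fun x => if x ∈ e then 1 else 0

/-- The lcm (componentwise max) of the monomials of a finite set of edges. -/
def eLcm {V : Type*} [DecidableEq V] (σ : Finset (Sym2 V)) : V → ℕ :=
  σ.sup edgeMon

/-- `σ` is a Scarf face of the edge ideal `I(G)`, identified with a set of edges of `G`:
its lcm is distinct from the lcm of any other set of edges of `G`. -/
def IsScarf {V : Type*} [DecidableEq V] (G : SimpleGraph V) (σ : Finset (Sym2 V)) : Prop :=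
  (∀ e ∈ σ, e ∈ G.edgeSet) ∧
    ∀ τ : Finset (Sym2 V), (∀ e ∈ τ, e ∈ G.edgeSet) → eLcm τ = eLcm σ → τ = σ

/-- `dist_G(e, f) = 0`: the two edges share a vertex. -/
def Dist0 {V : Type*} (e f : Sym2 V) : Prop := ∃ x, x ∈ e ∧ x ∈ f

/-- `dist_G(e, f) = 1`: the edges are vertex-disjoint, but some endpoint of `e` is
adjacent in `G` to some endpoint of `f`. -/
def Dist1 {V : Type*} (G : SimpleGraph V) (e f : Sym2 V) : Prop :=
  ¬ Dist0 e f ∧ ∃ x ∈ e, ∃ y ∈ f, G.Adj x y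

/-- Componentwise lcm (sup) of a finite set of exponent vectors. -/
def mLcm {V : Type*} (σ : Finset (V → ℕ)) : V → ℕ := σ.sup id

/-- `m` is a sum of `t` edge monomials of `G`, i.e. a generator of `I(G)^t`. -/
def IsEdgeSum {V : Type*} [DecidableEq V] (G : SimpleGraph V) (t : ℕ) (m : V → ℕ) : Prop :=
  ∃ s : Multiset (Sym2 V), (∀ e ∈ s, e ∈ G.edgeSet) ∧ Multiset.card s = t ∧
    (s.map edgeMon).sum = m

/-- `m` is a minimal generator of `I(G)^t`: it is a sum of `t` edge monomials of `G`,
minimal with respect to componentwise `≤` among all such sums. -/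
def IsMinGen {V : Type*} [DecidableEq V] (G : SimpleGraph V) (t : ℕ) (m : V → ℕ) : Prop :=
  IsEdgeSum G t m ∧ ∀ m', IsEdgeSum G t m' → m' ≤ m → m' = m

/-- `σ` is a Scarf face of `I(G)^t`: a set of minimal generators of `I(G)^t` whose lcm
is distinct from the lcm of any other set of minimal generators of `I(G)^t`. -/
def IsScarfPow {V : Type*} [DecidableEq V] (G : SimpleGraph V) (t : ℕ)
    (σ : Finset (V → ℕ)) : Prop :=
  (∀ m ∈ σ, IsMinGen G t m) ∧
    ∀ τ : Finset (V → ℕ), (∀ m ∈ τ, IsMinGen G t m) → mLcm τ = mLcm σ → τ = σ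

/-- The claw with center `a = 0` and leaves `b = 1`, `c = 2`, `d = 3`. -/
def clawG : SimpleGraph (Fin 4) :=
  SimpleGraph.fromEdgeSet {s(0, 1), s(0, 2), s(0, 3)}

theorem edgeSum_iff (t : ℕ) (m : Fin 4 → ℕ) :
    IsEdgeSum clawG t m ↔ ∃ i j k : ℕ, i + j + k = t ∧ m = ![t, i, j, k] := by
  constructor
  · rintro ⟨s, hs, rfl, rfl⟩
    induction s using Multiset.induction_on with
    | empty =>
      refine ⟨0, 0, 0, by simp, ?_⟩
      funext x
      fin_cases x <;> simp
    | cons e s ih =>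
      obtain ⟨i, j, k, h, hm⟩ := ih (fun e he => hs e (Multiset.mem_cons_of_mem he))
      have he := hs e (Multiset.mem_cons_self e s)
      rw [clawG, SimpleGraph.edgeSet_fromEdgeSet] at he
      simp only [Multiset.map_cons, Multiset.sum_cons, Multiset.card_cons, hm]
      rcases he.1 with rfl | rfl | rfl
      · refine ⟨i + 1, j, k, by omega, ?_⟩
        funext x
        fin_cases x <;> simp [edgeMon, add_comm]
      · refine ⟨i, j + 1, k, by omega, ?_⟩
        funext x
        fin_cases x <;> simp [edgeMon, add_comm]
      · refine ⟨i, j, k + 1, by omega, ?_⟩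
        funext x
        fin_cases x <;> simp [edgeMon, add_comm]
  · rintro ⟨i, j, k, h, rfl⟩
    refine ⟨Multiset.replicate i s(0, 1) + Multiset.replicate j s(0, 2)
      + Multiset.replicate k s(0, 3), ?_, by simp [h], ?_⟩
    · intro e he
      rw [clawG, SimpleGraph.edgeSet_fromEdgeSet]
      simp only [Multiset.mem_add, Multiset.mem_replicate] at he
      rcases he with (⟨_, rfl⟩ | ⟨_, rfl⟩) | ⟨_, rfl⟩ <;> simp
    · subst h
      funext x
      fin_cases x <;> simp [edgeMon]

theorem vec_le {t a b c i j k : ℕ} (h : ![t, a, b, c] ≤ ![t, i, j, k]) :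
    a ≤ i ∧ b ≤ j ∧ c ≤ k := ⟨h 1, h 2, h 3⟩

theorem vec_eq {t a b c i j k : ℕ} (h : ![t, a, b, c] = ![t, i, j, k]) :
    a = i ∧ b = j ∧ c = k := ⟨congrFun h 1, congrFun h 2, congrFun h 3⟩

theorem minGen_iff (t : ℕ) (m : Fin 4 → ℕ) :
    IsMinGen clawG t m ↔ ∃ i j k : ℕ, i + j + k = t ∧ m = ![t, i, j, k] := by
  constructor
  · rintro ⟨h, -⟩
    exact (edgeSum_iff t m).1 h
  · intro h
    refine ⟨(edgeSum_iff t m).2 h, ?_⟩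
    intro m' hm' hle
    obtain ⟨i, j, k, h, rfl⟩ := h
    obtain ⟨a, b, c, h', rfl⟩ := (edgeSum_iff t m').1 hm'
    obtain ⟨h1, h2, h3⟩ := vec_le hle
    obtain rfl : a = i := by omega
    obtain rfl : b = j := by omega
    obtain rfl : c = k := by omega
    rfl

theorem minGen_mk {t i j k : ℕ} (h : i + j + k = t) : IsMinGen clawG t ![t, i, j, k] :=
  (minGen_iff t _).2 ⟨i, j, k, h, rfl⟩

theorem le_mLcm {V : Type*} {σ : Finset (V → ℕ)} {m : V → ℕ} (h : m ∈ σ) : m ≤ mLcm σ :=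
  Finset.le_sup (f := id) h

theorem mLcm_le {V : Type*} {σ : Finset (V → ℕ)} {L : V → ℕ} (h : ∀ m ∈ σ, m ≤ L) :
    mLcm σ ≤ L := Finset.sup_le h

theorem scarf_mem {V : Type*} [DecidableEq V] {G : SimpleGraph V} {t : ℕ}
    {σ : Finset (V → ℕ)} (hσ : IsScarfPow G t σ) {m : V → ℕ} (hm : IsMinGen G t m)
    (hle : m ≤ mLcm σ) : m ∈ σ := by
  classical
  have h := hσ.2 (insert m σ) (by
    intro x hx
    rcases Finset.mem_insert.1 hx with rfl | hx
    · exact hm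
    · exact hσ.1 x hx) (by
    apply le_antisymm
    · apply mLcm_le
      intro x hx
      rcases Finset.mem_insert.1 hx with rfl | hx
      · exact hle
      · exact le_mLcm hx
    · exact mLcm_le fun x hx => le_mLcm (Finset.mem_insert_of_mem hx))
  rw [← h]
  exact Finset.mem_insert_self m σ

theorem scarf_sub {V : Type*} [DecidableEq V] {G : SimpleGraph V} {t : ℕ}
    {σ τ : Finset (V → ℕ)} (hσ : IsScarfPow G t σ) (hτ : τ ⊆ σ) : IsScarfPow G t τ := by
  classical
  refine ⟨fun m hm => hσ.1 m (hτ hm), ?_⟩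
  intro ρ hρ hl
  have hmono : mLcm τ ≤ mLcm σ := mLcm_le fun x hx => le_mLcm (hτ hx)
  have hρσ : ρ ⊆ σ := fun m hm => scarf_mem hσ (hρ m hm) ((le_mLcm hm).trans (hl.le.trans hmono))
  -- replacing one of the two sets by the other inside `σ` keeps the lcm
  have key : ∀ α β : Finset (V → ℕ), α ⊆ σ → β ⊆ σ → mLcm α = mLcm β → β ⊆ α := by
    intro α β hα hβ hab m hm
    by_contra hma
    have h := hσ.2 (σ.erase m) (fun x hx => hσ.1 x (Finset.mem_of_mem_erase hx)) (by
      apply le_antisymm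
      · exact mLcm_le fun x hx => le_mLcm (Finset.mem_of_mem_erase hx)
      · apply mLcm_le
        intro x hx
        by_cases hxm : x = m
        · subst hxm
          refine (le_mLcm hm).trans (hab.symm.le.trans (mLcm_le ?_))
          intro y hy
          exact le_mLcm (Finset.mem_erase.2 ⟨fun h => hma (h ▸ hy), hα hy⟩)
        · exact le_mLcm (Finset.mem_erase.2 ⟨hxm, hx⟩))
    have := hβ hm
    rw [← h] at this
    simp at this
  exact Finset.Subset.antisymm (key τ ρ hτ hρσ hl.symm) (key ρ τ hρσ hτ hl)

theorem pair_lcm (t i j k i' j' k' : ℕ) :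
    mLcm {![t, i, j, k], ![t, i', j', k']} = ![t, max i i', max j j', max k k'] := by
  funext x
  fin_cases x <;> simp [mLcm]

theorem pair_iff (t i j k i' j' k' : ℕ) (h : i + j + k = t) (h' : i' + j' + k' = t)
    (hne : (i, j, k) ≠ (i', j', k')) :
    IsScarfPow clawG t {![t, i, j, k], ![t, i', j', k']} ↔
          ((k = 0 ∧ k' = 0 ∧ (i = i' + 1 ∨ i' = i + 1)) ∨
            (j = 0 ∧ j' = 0 ∧ (i = i' + 1 ∨ i' = i + 1)) ∨
            (i = 0 ∧ i' = 0 ∧ (j = j' + 1 ∨ j' = j + 1))) := by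
  have hne' : ¬ (i = i' ∧ j = j' ∧ k = k') := by
    rintro ⟨rfl, rfl, rfl⟩
    exact hne rfl
  constructor
  · intro hs
    have key : ∀ a b c : ℕ, a + b + c = t → a ≤ max i i' → b ≤ max j j' → c ≤ max k k' →
        (a = i ∧ b = j ∧ c = k) ∨ (a = i' ∧ b = j' ∧ c = k') := by
      intro a b c habc ha hb hc
      have hm := scarf_mem hs (minGen_mk habc) (by
        rw [pair_lcm]
        intro x
        fin_cases x
        · exact le_refl t
        · exact ha
        · exact hb
        · exact hc)
      rcases Finset.mem_insert.1 hm with hm | hm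
      · exact Or.inl (vec_eq hm)
      · exact Or.inr (vec_eq (Finset.mem_singleton.1 hm))
    have hcase : (i < i' ∧ j' < j) ∨ (i < i' ∧ k' < k) ∨ (j < j' ∧ i' < i) ∨ (j < j' ∧ k' < k) ∨
        (k < k' ∧ i' < i) ∨ (k < k' ∧ j' < j) := by omega
    clear hs hne
    rcases hcase with ⟨p, q⟩ | ⟨p, q⟩ | ⟨p, q⟩ | ⟨p, q⟩ | ⟨p, q⟩ | ⟨p, q⟩
    · have k1 := key (i + 1) (j - 1) k (by omega) (by omega) (by omega) (by omega)
      have hz : k = 0 := by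
        by_contra hz
        have k2 := key (i + 1) j (k - 1) (by omega) (by omega) (by omega) (by omega)
        omega
      clear key
      omega
    · have k1 := key (i + 1) j (k - 1) (by omega) (by omega) (by omega) (by omega)
      have hz : j = 0 := by
        by_contra hz
        have k2 := key (i + 1) (j - 1) k (by omega) (by omega) (by omega) (by omega)
        omega
      clear key
      omega
    · have k1 := key (i - 1) (j + 1) k (by omega) (by omega) (by omega) (by omega)
      have hz : k = 0 := by
        by_contra hz
        have k2 := key i (j + 1) (k - 1) (by omega) (by omega) (by omega) (by omega)
        omega
      clear key
      omega
    · have k1 := key i (j + 1) (k - 1) (by omega) (by omega) (by omega) (by omega)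
      have hz : i = 0 := by
        by_contra hz
        have k2 := key (i - 1) (j + 1) k (by omega) (by omega) (by omega) (by omega)
        omega
      clear key
      omega
    · have k1 := key (i - 1) j (k + 1) (by omega) (by omega) (by omega) (by omega)
      have hz : j = 0 := by
        by_contra hz
        have k2 := key i (j - 1) (k + 1) (by omega) (by omega) (by omega) (by omega)
        omega
      clear key
      omega
    · have k1 := key i (j - 1) (k + 1) (by omega) (by omega) (by omega) (by omega)
      have hz : i = 0 := by
        by_contra hz
        have k2 := key (i - 1) j (k + 1) (by omega) (by omega) (by omega) (by omega)
        omega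
      clear key
      omega
  · intro hc
    refine ⟨?_, ?_⟩
    · intro m hm
      rcases Finset.mem_insert.1 hm with rfl | hm
      · exact minGen_mk h
      · rw [Finset.mem_singleton.1 hm]
        exact minGen_mk h'
    · intro τ hτ hl
      rw [pair_lcm] at hl
      have hsub : ∀ m ∈ τ, m = ![t, i, j, k] ∨ m = ![t, i', j', k'] := by
        intro m hm
        obtain ⟨a, b, c, habc, rfl⟩ := (minGen_iff t m).1 (hτ m hm)
        obtain ⟨h1, h2, h3⟩ := vec_le ((le_mLcm hm).trans hl.le)
        have : (a = i ∧ b = j ∧ c = k) ∨ (a = i' ∧ b = j' ∧ c = k') := by omega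
        rcases this with ⟨rfl, rfl, rfl⟩ | ⟨rfl, rfl, rfl⟩
        · exact Or.inl rfl
        · exact Or.inr rfl
      ext m
      constructor
      · intro hm
        simpa using hsub m hm
      · intro hm
        by_contra hmt
        rcases Finset.mem_insert.1 hm with rfl | hm
        · have hle : mLcm τ ≤ ![t, i', j', k'] := mLcm_le (by
            intro x hx
            rcases hsub x hx with rfl | rfl
            · exact absurd hx hmt
            · exact le_rfl)
          rw [hl] at hle
          obtain ⟨h1, h2, h3⟩ := vec_le hle
          omega
        · rw [Finset.mem_singleton] at hm
          subst hm
          have hle : mLcm τ ≤ ![t, i, j, k] := mLcm_le (by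
            intro x hx
            rcases hsub x hx with rfl | rfl
            · exact le_rfl
            · exact absurd hx hmt)
          rw [hl] at hle
          obtain ⟨h1, h2, h3⟩ := vec_le hle
          omega

theorem gauss_choose (t : ℕ) : ∑ s ∈ Finset.range (t + 1), (s + 1) = Nat.choose (t + 2) 2 := by
  induction t with
  | zero => simp
  | succ n ih =>
    rw [Finset.sum_range_succ, ih, Nat.choose_succ_succ' (n + 2) 1, Nat.choose_one_right]
    ring

theorem gens_ncard (t : ℕ) :
    {m : Fin 4 → ℕ | IsMinGen clawG t m}.ncard = Nat.choose (t + 2) 2 := by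
  classical
  let S : Finset (Σ _ : ℕ, ℕ) := (Finset.range (t + 1)).sigma (fun s => Finset.range (s + 1))
  let f : (Σ _ : ℕ, ℕ) → (Fin 4 → ℕ) := fun p => ![t, t - p.1, p.2, p.1 - p.2]
  have hS : {m : Fin 4 → ℕ | IsMinGen clawG t m} = ↑(S.image f) := by
    ext m
    simp only [Set.mem_ofPred_eq, minGen_iff, Finset.coe_image, Set.mem_image, Finset.mem_coe,
      S, f, Finset.mem_sigma, Finset.mem_range]
    constructor
    · rintro ⟨i, j, k, h, rfl⟩
      refine ⟨⟨j + k, j⟩, ⟨by dsimp only; omega, by dsimp only; omega⟩, ?_⟩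
      have h1 : t - (j + k) = i := by omega
      have h2 : j + k - j = k := by omega
      simp only [h1, h2]
    · rintro ⟨⟨s, j⟩, ⟨h1, h2⟩, rfl⟩
      dsimp only at h1 h2 ⊢
      exact ⟨t - s, j, s - j, by omega, rfl⟩
  rw [hS, Set.ncard_coe_finset, Finset.card_image_of_injOn]
  · simp only [S, Finset.card_sigma, Finset.card_range]
    exact gauss_choose t
  · rintro ⟨s, j⟩ hp ⟨s', j'⟩ hq hpq
    simp only [S, Finset.coe_sigma, Set.mem_sigma_iff, Finset.mem_coe, Finset.mem_range] at hp hq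
    obtain ⟨h1, h2, h3⟩ := vec_eq hpq
    dsimp only at h1 h2 h3
    obtain rfl : s = s' := by omega
    obtain rfl : j = j' := by omega
    rfl

theorem card_le (t : ℕ) (ht : 2 ≤ t) (σ : Finset (Fin 4 → ℕ)) (hσ : IsScarfPow clawG t σ) :
    σ.card ≤ 2 := by
  by_contra hcon
  obtain ⟨u, v, w, hu, hv, hw, huv, huw, hvw⟩ := Finset.two_lt_card_iff.1 (not_le.1 hcon)
  obtain ⟨a, b, c, h1, rfl⟩ := (minGen_iff t u).1 (hσ.1 u hu)
  obtain ⟨a', b', c', h2, rfl⟩ := (minGen_iff t v).1 (hσ.1 v hv)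
  obtain ⟨a'', b'', c'', h3, rfl⟩ := (minGen_iff t w).1 (hσ.1 w hw)
  have p1 := (pair_iff t _ _ _ _ _ _ h1 h2 (by
    intro h
    simp only [Prod.mk.injEq] at h
    obtain ⟨rfl, rfl, rfl⟩ := h
    exact huv rfl)).1 (scarf_sub hσ (by
      intro x hx
      rcases Finset.mem_insert.1 hx with rfl | hx
      · exact hu
      · rwa [Finset.mem_singleton.1 hx]))
  have p2 := (pair_iff t _ _ _ _ _ _ h1 h3 (by
    intro h
    simp only [Prod.mk.injEq] at h
    obtain ⟨rfl, rfl, rfl⟩ := h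
    exact huw rfl)).1 (scarf_sub hσ (by
      intro x hx
      rcases Finset.mem_insert.1 hx with rfl | hx
      · exact hu
      · rwa [Finset.mem_singleton.1 hx]))
  have p3 := (pair_iff t _ _ _ _ _ _ h2 h3 (by
    intro h
    simp only [Prod.mk.injEq] at h
    obtain ⟨rfl, rfl, rfl⟩ := h
    exact hvw rfl)).1 (scarf_sub hσ (by
      intro x hx
      rcases Finset.mem_insert.1 hx with rfl | hx
      · exact hv
      · rwa [Finset.mem_singleton.1 hx]))
  clear huv huw hvw hu hv hw hcon hσ
  rcases p1 with p1 | p1 | p1 <;> rcases p2 with p2 | p2 | p2 <;> rcases p3 with p3 | p3 | p3 <;>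
    omega

theorem stmt18 (t : ℕ) (ht : 2 ≤ t) :
    (∀ m : Fin 4 → ℕ, IsMinGen clawG t m ↔
        ∃ i j k : ℕ, i + j + k = t ∧ m = ![t, i, j, k]) ∧
    {m : Fin 4 → ℕ | IsMinGen clawG t m}.ncard = Nat.choose (t + 2) 2 ∧
    (∀ i j k i' j' k' : ℕ, i + j + k = t → i' + j' + k' = t →
        (i, j, k) ≠ (i', j', k') →
        (IsScarfPow clawG t {![t, i, j, k], ![t, i', j', k']} ↔
          ((k = 0 ∧ k' = 0 ∧ (i = i' + 1 ∨ i' = i + 1)) ∨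
            (j = 0 ∧ j' = 0 ∧ (i = i' + 1 ∨ i' = i + 1)) ∨
            (i = 0 ∧ i' = 0 ∧ (j = j' + 1 ∨ j' = j + 1))))) ∧
    (∀ σ : Finset (Fin 4 → ℕ), IsScarfPow clawG t σ → σ.card ≤ 2) := by
  exact ⟨minGen_iff t, gens_ncard t, pair_iff t, card_le t ht⟩
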